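/- Theorem 1 (preparation classicality for all projective measurements): let d ≥ 2, η ∈ (0,1], and let (ρ_x)_{x∈X} be d-dimensional quantum states. Let {(Π_{b|y})_b}_{y∈Y} be a finite collection of rank-1 projective measurements on ℂ^d, and define O_x = (ρ_x − (1−η)·I_d/d)/η. Assume that for every rank-1 projective measurement (Π_b)_{b} on ℂ^d, its depolarized version (η·Π_b + (1−η)·I_d/d)_b is simulable by {(Π_{b|y})}_{y∈Y} with classical pre- and post-processing. If the probe behavior p(b|x,y) = tr(Π_{b|y} O_x) admits a classical model with message alphabet A, then for every finite family of projective measurements on ℂ^d (of any rank), the behavior generated by the states (ρ_x) admits a classical model with message alphabet A. -/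

import Mathlib

open Matrix BigOperators ComplexOrder

noncomputable section

/-- A behavior `p b x y` admits a classical model with message alphabet `A`:
there exist a finite set `Λ` (wlog `Fin n`), a probability distribution `pr` on it,
and conditional distributions `pa a x l` on `A` and `pb b a y l` on `B` such that
`p b x y = ∑ l, ∑ a, pr l * pa a x l * pb b a y l`. -/
def HasClassicalModel (A : Type) [Fintype A] {B X Y : Type} [Fintype B]
    (p : B → X → Y → ℝ) : Prop :=
  ∃ (n : ℕ) (pr : Fin n → ℝ) (pa : A → X → Fin n → ℝ) (pb : B → A → Y → Fin n → ℝ),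
    (∀ l, 0 ≤ pr l) ∧ (∑ l, pr l = 1) ∧
    (∀ a x l, 0 ≤ pa a x l) ∧ (∀ x l, ∑ a, pa a x l = 1) ∧
    (∀ b a y l, 0 ≤ pb b a y l) ∧ (∀ a y l, ∑ b, pb b a y l = 1) ∧
    (∀ b x y, p b x y = ∑ l, ∑ a, pr l * pa a x l * pb b a y l)

/-- A `d`-dimensional quantum state: positive semidefinite with trace 1. -/
def IsState {d : ℕ} (ρ : Matrix (Fin d) (Fin d) ℂ) : Prop :=
  ρ.PosSemidef ∧ ρ.trace = 1

/-- A POVM with outcome set `B`: positive semidefinite effects summing to the identity. -/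
def IsPOVM {d : ℕ} {B : Type} [Fintype B] (M : B → Matrix (Fin d) (Fin d) ℂ) : Prop :=
  (∀ b, (M b).PosSemidef) ∧ (∑ b, M b) = 1

/-- A projective measurement: orthogonal projections summing to the identity. -/
def IsProjMeasurement {d : ℕ} {B : Type} [Fintype B]
    (P : B → Matrix (Fin d) (Fin d) ℂ) : Prop :=
  (∀ b, (P b).IsHermitian) ∧ (∀ b, P b * P b = P b) ∧ (∑ b, P b) = 1

/-- A rank-1 projective measurement: a projective measurement whose projectors have trace 1. -/
def IsRankOneProjMeasurement {d : ℕ} {B : Type} [Fintype B]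
    (P : B → Matrix (Fin d) (Fin d) ℂ) : Prop :=
  IsProjMeasurement P ∧ ∀ b, (P b).trace = 1

/-- The POVM `N` is simulable by the finite collection of POVMs `M` with classical
pre- and post-processing. -/
def SimulableBy {d : ℕ} {B₂ Y₀ B₁ : Type} [Fintype B₂] [Fintype Y₀] [Fintype B₁]
    (N : B₂ → Matrix (Fin d) (Fin d) ℂ) (M : Y₀ → B₁ → Matrix (Fin d) (Fin d) ℂ) : Prop :=
  ∃ (q : Y₀ → ℝ) (r : B₂ → B₁ → Y₀ → ℝ),
    (∀ y, 0 ≤ q y) ∧ (∑ y, q y = 1) ∧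
    (∀ b b' y, 0 ≤ r b b' y) ∧ (∀ b' y, ∑ b, r b b' y = 1) ∧
    (∀ b, N b = ∑ y, ∑ b', (q y * r b b' y) • M y b')

/-- The projections of a projective measurement are pairwise orthogonal. -/
theorem IsProjMeasurement.mul_eq_zero {d : ℕ} {B : Type} [Fintype B]
    {P : B → Matrix (Fin d) (Fin d) ℂ} (hP : IsProjMeasurement P) {b c : B} (hbc : b ≠ c) :
    P b * P c = 0 := by
  classical
  obtain ⟨hH, hI, hS⟩ := hP
  have key : ∀ e, (P e * P c)ᴴ * (P e * P c) = P c * P e * P c := fun e => by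
    rw [conjTranspose_mul, (hH e).eq, (hH c).eq, mul_assoc, ← mul_assoc (P e) (P e), hI,
      ← mul_assoc]
  have hnn : ∀ e, 0 ≤ (P c * P e * P c).trace := fun e => by
    rw [← key e]
    exact (posSemidef_conjTranspose_mul_self _).trace_nonneg
  have hsum : ∑ e, (P c * P e * P c).trace = (P c).trace := by
    rw [← trace_sum, ← Finset.sum_mul, ← Finset.mul_sum, hS, mul_one, hI]
  have hzero : ∑ e ∈ Finset.univ.erase c, (P c * P e * P c).trace = 0 := by
    rw [← Finset.add_sum_erase _ _ (Finset.mem_univ c), hI, hI] at hsum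
    simpa using hsum
  have hb := (Finset.sum_eq_zero_iff_of_nonneg fun e _ => hnn e).1 hzero b
    (Finset.mem_erase.2 ⟨hbc, Finset.mem_univ b⟩)
  rwa [← key b, trace_conjTranspose_mul_self_eq_zero_iff] at hb

/-- The projections of a projective measurement are simultaneously diagonalizable. -/
theorem IsProjMeasurement.exists_unitary {d m : ℕ} {Q : Fin m → Matrix (Fin d) (Fin d) ℂ}
    (hQ : IsProjMeasurement Q) :
    ∃ (U : unitaryGroup (Fin d) ℂ) (f : Fin d → Fin m), ∀ b,
      Q b = (U : Matrix (Fin d) (Fin d) ℂ) * diagonal (fun i => if f i = b then 1 else 0) *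
        star (U : Matrix (Fin d) (Fin d) ℂ) := by
  obtain ⟨hH, hI, hS⟩ := id hQ
  set H : Matrix (Fin d) (Fin d) ℂ := ∑ b : Fin m, ((b : ℕ) : ℂ) • Q b with hHdef
  have hHerm : H.IsHermitian := by
    simp only [IsHermitian, hHdef, conjTranspose_sum, conjTranspose_smul, (hH _).eq]
    simp
  have hHQ : ∀ b, H * Q b = ((b : ℕ) : ℂ) • Q b := fun b => by
    rw [hHdef, Finset.sum_mul, Finset.sum_eq_single b]
    · rw [smul_mul_assoc, hI]
    · intro c _ hc
      rw [smul_mul_assoc, hQ.mul_eq_zero hc, smul_zero]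
    · simp
  set U := hHerm.eigenvectorUnitary
  set V : Matrix (Fin d) (Fin d) ℂ := U.1
  have hVV : V * star V = 1 := Unitary.mul_star_self_of_mem U.2
  have hVV' : star V * V = 1 := Unitary.star_mul_self_of_mem U.2
  set D : Matrix (Fin d) (Fin d) ℂ := diagonal (RCLike.ofReal ∘ hHerm.eigenvalues)
  have hspec : H = V * D * star V := by
    have h := hHerm.spectral_theorem
    rwa [Unitary.conjStarAlgAut_apply] at h
  let R : Fin m → Matrix (Fin d) (Fin d) ℂ := fun b => star V * Q b * V
  have hQR : ∀ b, Q b = V * R b * star V := fun b => by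
    calc Q b = (V * star V) * Q b * (V * star V) := by rw [hVV, one_mul, mul_one]
      _ = _ := by simp only [R, mul_assoc]
  have hDR : ∀ b, D * R b = ((b : ℕ) : ℂ) • R b := fun b => by
    calc D * R b = (star V * V) * D * (star V * Q b * V) := by rw [hVV', one_mul]
      _ = star V * (V * D * star V * Q b) * V := by simp only [mul_assoc]
      _ = _ := by rw [← hspec, hHQ, mul_smul_comm, smul_mul_assoc]
  have hRsum : ∑ b, R b = 1 := by
    simp only [R]
    rw [← Finset.sum_mul, ← Finset.mul_sum, hS, mul_one, hVV']
  have hentry : ∀ b i j, R b i j ≠ 0 → (hHerm.eigenvalues i : ℂ) = ((b : ℕ) : ℂ) := by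
    intro b i j hne
    have h := congrFun (congrFun (hDR b) i) j
    rw [diagonal_mul, Matrix.smul_apply, smul_eq_mul] at h
    exact mul_right_cancel₀ hne h
  have hex : ∀ i, ∃ b : Fin m, (hHerm.eigenvalues i : ℂ) = ((b : ℕ) : ℂ) := by
    intro i
    by_contra! hcon
    have h := congrFun (congrFun hRsum i) i
    rw [Matrix.sum_apply, Finset.sum_eq_zero, one_apply_eq] at h
    · exact zero_ne_one h
    · intro b _
      by_contra hne
      exact hcon b (hentry b i i hne)
  choose f hf using hex
  have hoff : ∀ b i j, f i ≠ b → R b i j = 0 := by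
    intro b i j hne
    by_contra hR
    have h := (hf i).symm.trans (hentry b i j hR)
    exact hne (Fin.ext (by exact_mod_cast h))
  refine ⟨U, f, fun b => ?_⟩
  have hR : R b = diagonal (fun i => if f i = b then 1 else 0) := by
    ext i j
    rw [diagonal_apply]
    by_cases hb : f i = b
    · have h := congrFun (congrFun hRsum i) j
      rw [Matrix.sum_apply, Finset.sum_eq_single b, one_apply] at h
      · simpa [hb] using h
      · intro c _ hc
        exact hoff c i j fun h => hc (h.symm.trans hb)
      · simp
    · rw [hoff b i j hb]
      simp [hb]
  rw [← hR]
  exact hQR b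

/-- Every projective measurement is a coarse-graining of a rank-1 projective measurement. -/
theorem IsProjMeasurement.exists_rankOne_refinement {d m : ℕ}
    {Q : Fin m → Matrix (Fin d) (Fin d) ℂ} (hQ : IsProjMeasurement Q) :
    ∃ (P : Fin d → Matrix (Fin d) (Fin d) ℂ) (f : Fin d → Fin m),
      IsRankOneProjMeasurement P ∧ ∀ b, Q b = ∑ i, (if f i = b then (1 : ℝ) else 0) • P i := by
  obtain ⟨U, f, hf⟩ := hQ.exists_unitary
  set V : Matrix (Fin d) (Fin d) ℂ := U.1
  have hVV : V * star V = 1 := Unitary.mul_star_self_of_mem U.2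
  have hVV' : star V * V = 1 := Unitary.star_mul_self_of_mem U.2
  refine ⟨fun i => V * single i i 1 * star V, f, ⟨⟨fun i => ?_, fun i => ?_, ?_⟩, fun i => ?_⟩,
    fun b => ?_⟩
  · simp [IsHermitian, star_eq_conjTranspose, conjTranspose_mul, mul_assoc]
  · calc V * single i i 1 * star V * (V * single i i 1 * star V)
        = V * single i i 1 * (star V * V) * single i i 1 * star V := by simp only [mul_assoc]
      _ = _ := by rw [hVV', mul_one, mul_assoc V, single_mul_single_same, one_mul]
  · rw [← Finset.sum_mul, ← Finset.mul_sum, sum_single_one, mul_one, hVV]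
  · rw [trace_mul_comm, ← mul_assoc, hVV', one_mul, trace_single_eq_same]
  · have hdiag : diagonal (fun i => if f i = b then (1 : ℂ) else 0) =
        ∑ i, (if f i = b then (1 : ℝ) else 0) • single i i (1 : ℂ) := by
      rw [← sum_single_eq_diagonal]
      refine Finset.sum_congr rfl fun i _ => ?_
      split_ifs <;> simp
    rw [hf, hdiag, Finset.mul_sum, Finset.sum_mul]
    simp only [mul_smul_comm, smul_mul_assoc]

/-- Simulability is preserved by coarse-graining outcomes. -/
theorem SimulableBy.coarseGrain {d : ℕ} {B₃ B₂ Y₀ B₁ : Type} [Fintype B₃] [DecidableEq B₃]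
    [Fintype B₂] [Fintype Y₀] [Fintype B₁]
    {N : B₂ → Matrix (Fin d) (Fin d) ℂ} {M : Y₀ → B₁ → Matrix (Fin d) (Fin d) ℂ}
    (h : SimulableBy N M) (f : B₂ → B₃) :
    SimulableBy (fun b => ∑ i, (if f i = b then (1 : ℝ) else 0) • N i) M := by
  obtain ⟨q, r, hq, hq1, hr, hr1, hN⟩ := h
  refine ⟨q, fun b b' y => ∑ i, (if f i = b then 1 else 0) * r i b' y, hq, hq1,
    fun b b' y => Finset.sum_nonneg fun i _ => mul_nonneg (by split_ifs <;> simp) (hr i b' y),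
    fun b' y => ?_, fun b => ?_⟩
  · rw [Finset.sum_comm]
    simp [hr1]
  · simp only [hN, Finset.smul_sum, smul_smul, Finset.mul_sum, Finset.sum_smul]
    rw [Finset.sum_comm]
    refine Finset.sum_congr rfl fun y _ => ?_
    rw [Finset.sum_comm]
    refine Finset.sum_congr rfl fun b' _ => Finset.sum_congr rfl fun i _ => ?_
    congr 1
    ring

/-- A classical model for given measurements yields one for all measurements they simulate. -/
theorem HasClassicalModel.of_simulableBy {d : ℕ} {A X Y B Y' B' : Type} [Fintype A] [Fintype Y]
    [Fintype B] [Fintype B'] {M : Y → B → Matrix (Fin d) (Fin d) ℂ}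
    {N : Y' → B' → Matrix (Fin d) (Fin d) ℂ} {O : X → Matrix (Fin d) (Fin d) ℂ}
    (hM : HasClassicalModel A (fun b x y => (Matrix.trace (M y b * O x)).re))
    (hN : ∀ y, SimulableBy (N y) M) :
    HasClassicalModel A (fun b x y => (Matrix.trace (N y b * O x)).re) := by
  obtain ⟨n, pr, pa, pb, hpr, hpr1, hpa, hpa1, hpb, hpb1, hp⟩ := hM
  choose q r hq hq1 hr hr1 hN using hN
  refine ⟨n, pr, pa, fun b a y l => ∑ z, ∑ c, q y z * r y b c z * pb c a z l,
    hpr, hpr1, hpa, hpa1, fun b a y l => ?_, fun a y l => ?_, fun b x y => ?_⟩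
  · exact Finset.sum_nonneg fun z _ => Finset.sum_nonneg fun c _ =>
      mul_nonneg (mul_nonneg (hq y z) (hr y b c z)) (hpb c a z l)
  · rw [Finset.sum_comm, ← hq1 y]
    refine Finset.sum_congr rfl fun z _ => ?_
    rw [Finset.sum_comm]
    simp only [← Finset.sum_mul, ← Finset.mul_sum, hr1, mul_one, hpb1]
  · have htr : (Matrix.trace (N y b * O x)).re =
        ∑ z, ∑ c, q y z * r y b c z * (Matrix.trace (M z c * O x)).re := by
      simp only [hN, Finset.sum_mul, trace_sum, smul_mul_assoc, trace_smul, Complex.re_sum,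
        Complex.smul_re, smul_eq_mul]
    simp only [htr, hp, Finset.mul_sum]
    calc _ = ∑ z, ∑ l, ∑ c, ∑ a, q y z * r y b c z * (pr l * pa a x l * pb c a z l) :=
          Finset.sum_congr rfl fun z _ => Finset.sum_comm
      _ = ∑ l, ∑ z, ∑ c, ∑ a, q y z * r y b c z * (pr l * pa a x l * pb c a z l) :=
          Finset.sum_comm
      _ = _ := by
        refine Finset.sum_congr rfl fun l _ => ?_
        calc _ = ∑ z, ∑ a, ∑ c, q y z * r y b c z * (pr l * pa a x l * pb c a z l) :=
              Finset.sum_congr rfl fun z _ => Finset.sum_comm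
          _ = ∑ a, ∑ z, ∑ c, q y z * r y b c z * (pr l * pa a x l * pb c a z l) :=
              Finset.sum_comm
          _ = _ := Finset.sum_congr rfl fun a _ => Finset.sum_congr rfl fun z _ =>
              Finset.sum_congr rfl fun c _ => by ring

/-- Depolarizing a trace-one effect undoes the inverse depolarization of a trace-one operator. -/
theorem trace_depolarized_mul {d : ℕ} (hd : d ≠ 0) {η : ℝ} (hη : η ≠ 0)
    {P ρ : Matrix (Fin d) (Fin d) ℂ} (hP : P.trace = 1) (hρ : ρ.trace = 1) :
    ((η • P + ((1 - η) / (d : ℝ)) • (1 : Matrix (Fin d) (Fin d) ℂ)) *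
      (η⁻¹ • (ρ - ((1 - η) / (d : ℝ)) • (1 : Matrix (Fin d) (Fin d) ℂ)))).trace =
      (P * ρ).trace := by
  have hd' : (d : ℂ) ≠ 0 := Nat.cast_ne_zero.2 hd
  have hη' : (η : ℂ) ≠ 0 := Complex.ofReal_ne_zero.2 hη
  simp only [mul_smul_comm, add_mul, mul_sub, smul_mul_assoc, mul_one, one_mul, trace_smul,
    trace_add, trace_sub, hP, hρ, trace_one, Fintype.card_fin, Complex.real_smul]
  push_cast
  field_simp
  ring

/-- **Theorem 1 of the paper.** Preparation classicality for all projective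
measurements.  Let `η ∈ (0,1]`, let `Π` be a finite collection of rank-1 projective
measurements such that the depolarized version of every rank-1 projective measurement on
`ℂ^d` is simulable by `Π` with classical pre- and post-processing, and let
`O_x = (ρ_x - (1-η)•I/d)/η`.  If the probe behavior `tr (Π_{b|y} O_x)` admits a classical
model with alphabet `A`, then the behavior generated by the states `ρ_x` under any finite
family of projective measurements (of any rank) admits a classical model with alphabet `A`. -/
theorem preparation_classicality_for_all_projective_measurements
    (d : ℕ) (hd : 2 ≤ d) (η : ℝ) (hη : η ∈ Set.Ioc (0 : ℝ) 1)
    (X A Y B : Type) [Fintype X] [Fintype A] [Fintype Y] [Fintype B]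
    [Nonempty X] [Nonempty A] [Nonempty Y] [Nonempty B]
    (ρ : X → Matrix (Fin d) (Fin d) ℂ) (hρ : ∀ x, IsState (ρ x))
    (Pi : Y → B → Matrix (Fin d) (Fin d) ℂ)
    (hPi : ∀ y, IsRankOneProjMeasurement (Pi y))
    (O : X → Matrix (Fin d) (Fin d) ℂ)
    (hO : ∀ x, O x = η⁻¹ • (ρ x - ((1 - η) / (d : ℝ)) • (1 : Matrix (Fin d) (Fin d) ℂ)))
    (hsim : ∀ P : Fin d → Matrix (Fin d) (Fin d) ℂ, IsRankOneProjMeasurement P →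
      SimulableBy
        (fun b => η • P b + ((1 - η) / (d : ℝ)) • (1 : Matrix (Fin d) (Fin d) ℂ)) Pi)
    (hcl : HasClassicalModel A (fun b x y => (Matrix.trace (Pi y b * O x)).re)) :
    ∀ (nY nB : ℕ) (Q : Fin nY → Fin nB → Matrix (Fin d) (Fin d) ℂ),
      (∀ y, IsProjMeasurement (Q y)) →
      HasClassicalModel A (fun b x y => (Matrix.trace (Q y b * ρ x)).re) := by
  intro nY nB Q hQ
  have hd0 : d ≠ 0 := by omega
  choose P f hP hPQ using fun y => (hQ y).exists_rankOne_refinement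
  have h := hcl.of_simulableBy fun y => (hsim (P y) (hP y)).coarseGrain (f y)
  convert h using 5 with b x y
  simp only [hPQ, hO, Finset.sum_mul, trace_sum, smul_mul_assoc, trace_smul,
    trace_depolarized_mul hd0 hη.1.ne' ((hP y).2 _) (hρ x).2]
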